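/- arXiv:1009.1585 — 2 statements merged into one kernel-verified Lean document; each statement's English description precedes it below -/
import Mathlib

section
/- Suppose the target Ω is convex, so T is convex, and assume T is lower semicontinuous around x̄. Then: (i) if x̄ ∈ Ω, the singular subdifferential satisfies ∂^∞ T(x̄) = N(x̄; Ω) ∩ F*_+; (ii) if x̄ ∉ Ω and T(x̄) < ∞, then ∂^∞ T(x̄) = N(x̄; Ω_r) ∩ F*_+ with r = T(x̄). Here N(x̄; Θ) := {x* ∈ X* : ⟨x*, x − x̄⟩ ≤ 0 for all x ∈ Θ} is the normal cone of convex analysis and F*_+ := {x* ∈ X* : ⟨x*, v⟩ ≥ 0 for all v ∈ F}. -/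
open Set Filter Topology Pointwise
open scoped ENNReal

variable {X : Type*}

/-- Minimal time function `T(x) = inf{t ≥ 0 : Ω ∩ (x + tF) ≠ ∅}`, with `inf ∅ = ∞`. -/
noncomputable def mtime [NormedAddCommGroup X] [NormedSpace ℝ X]
    (Ω F : Set X) (x : X) : ℝ≥0∞ :=
  ⨅ (t : ℝ) (_ : 0 ≤ t ∧ ∃ q ∈ F, x + t • q ∈ Ω), ENNReal.ofReal t

/-- Minkowski gauge `ρ_F(u) = inf{t ≥ 0 : u ∈ tF}`, with `inf ∅ = ∞`. -/
noncomputable def mgauge [NormedAddCommGroup X] [NormedSpace ℝ X]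
    (F : Set X) (u : X) : ℝ≥0∞ :=
  ⨅ (t : ℝ) (_ : 0 ≤ t ∧ ∃ q ∈ F, u = t • q), ENNReal.ofReal t

/-- Enlargement `Ω_r = {x : T(x) ≤ r}` of the target set. -/
noncomputable def enl [NormedAddCommGroup X] [NormedSpace ℝ X]
    (Ω F : Set X) (r : ℝ) : Set X :=
  {x | mtime Ω F x ≤ ENNReal.ofReal r}

/-- Generalized (minimal time) projection `Π(x) = (x + T(x)·F) ∩ Ω`. -/
noncomputable def mproj [NormedAddCommGroup X] [NormedSpace ℝ X]
    (Ω F : Set X) (x : X) : Set X :=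
  {w | w ∈ Ω ∧ ∃ q ∈ F, w = x + (mtime Ω F x).toReal • q}

/-- Support function `σ_F(x*) = sup_{q ∈ F} ⟨x*, q⟩`. -/
noncomputable def suppFn [NormedAddCommGroup X] [NormedSpace ℝ X]
    (F : Set X) (p : X →L[ℝ] ℝ) : ℝ :=
  sSup ((fun q => p q) '' F)

/-- Dynamics bound `‖F‖ = sup{‖q‖ : q ∈ F}`. -/
noncomputable def dynBound [NormedAddCommGroup X] (F : Set X) : ℝ :=
  sSup ((fun q => ‖q‖) '' F)

/-- Fréchet `ε`-subdifferential of `φ` at `xb`: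
`liminf_{x→xb} (φ(x) − φ(xb) − ⟨x*, x−xb⟩)/‖x−xb‖ ≥ −ε`. -/
def fsub [NormedAddCommGroup X] [NormedSpace ℝ X]
    (φ : X → ℝ≥0∞) (ε : ℝ) (xb : X) : Set (X →L[ℝ] ℝ) :=
  {p | ∀ γ > (0:ℝ), ∃ δ > (0:ℝ), ∀ x, ‖x - xb‖ < δ →
    ENNReal.ofReal ((φ xb).toReal + p (x - xb) - (ε + γ) * ‖x - xb‖) ≤ φ x}

/-- Set of `ε`-normals to `Θ` at `xb ∈ Θ`. -/
def enormal [NormedAddCommGroup X] [NormedSpace ℝ X]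
    (Θ : Set X) (ε : ℝ) (xb : X) : Set (X →L[ℝ] ℝ) :=
  {p | ∀ γ > (0:ℝ), ∃ δ > (0:ℝ), ∀ x ∈ Θ, ‖x - xb‖ < δ →
    p (x - xb) ≤ (ε + γ) * ‖x - xb‖}

/-- Basic (limiting/Mordukhovich) normal cone. -/
def bnormal [NormedAddCommGroup X] [NormedSpace ℝ X]
    (Θ : Set X) (xb : X) : Set (X →L[ℝ] ℝ) :=
  {p | ∃ (ε : ℕ → ℝ) (x : ℕ → X) (ps : ℕ → X →L[ℝ] ℝ),
    (∀ k, 0 ≤ ε k) ∧ Tendsto ε atTop (𝓝 0) ∧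
    (∀ k, x k ∈ Θ) ∧ Tendsto x atTop (𝓝 xb) ∧
    (∀ k, ps k ∈ enormal Θ (ε k) (x k)) ∧
    (∀ v, Tendsto (fun k => ps k v) atTop (𝓝 (p v)))}

/-- Basic (limiting/Mordukhovich) subdifferential. -/
def bsub [NormedAddCommGroup X] [NormedSpace ℝ X]
    (φ : X → ℝ≥0∞) (xb : X) : Set (X →L[ℝ] ℝ) :=
  {p | ∃ (ε : ℕ → ℝ) (x : ℕ → X) (ps : ℕ → X →L[ℝ] ℝ),
    (∀ k, 0 ≤ ε k) ∧ Tendsto ε atTop (𝓝 0) ∧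
    Tendsto x atTop (𝓝 xb) ∧
    Tendsto (fun k => φ (x k)) atTop (𝓝 (φ xb)) ∧
    (∀ k, ps k ∈ fsub φ (ε k) (x k)) ∧
    (∀ v, Tendsto (fun k => ps k v) atTop (𝓝 (p v)))}

/-- Singular (Mordukhovich) subdifferential. -/
def ssub [NormedAddCommGroup X] [NormedSpace ℝ X]
    (φ : X → ℝ≥0∞) (xb : X) : Set (X →L[ℝ] ℝ) :=
  {p | ∃ (ε lam : ℕ → ℝ) (x : ℕ → X) (ps : ℕ → X →L[ℝ] ℝ),
    (∀ k, 0 ≤ ε k) ∧ Tendsto ε atTop (𝓝 0) ∧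
    (∀ k, 0 < lam k) ∧ Tendsto lam atTop (𝓝 0) ∧
    Tendsto x atTop (𝓝 xb) ∧
    Tendsto (fun k => φ (x k)) atTop (𝓝 (φ xb)) ∧
    (∀ k, ps k ∈ fsub φ (ε k) (x k)) ∧
    (∀ v, Tendsto (fun k => lam k * ps k v) atTop (𝓝 (p v)))}

/-- Subdifferential of convex analysis (for `ℝ≥0∞`-valued convex functions,
finite at the reference point). -/
def csub [NormedAddCommGroup X] [NormedSpace ℝ X]
    (φ : X → ℝ≥0∞) (xb : X) : Set (X →L[ℝ] ℝ) :=
  {p | ∀ x, ENNReal.ofReal (p (x - xb) + (φ xb).toReal) ≤ φ x}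

/-- Normal cone of convex analysis. -/
def cnormal [NormedAddCommGroup X] [NormedSpace ℝ X]
    (Θ : Set X) (xb : X) : Set (X →L[ℝ] ℝ) :=
  {p | ∀ x ∈ Θ, p (x - xb) ≤ 0}


/-- **Ekeland's variational principle** for extended nonnegative lower semicontinuous functions. -/
theorem LowerSemicontinuous.exists_ekeland {α : Type*} [MetricSpace α] [CompleteSpace α]
    {f : α → ℝ≥0∞} (hf : LowerSemicontinuous f) {x₀ : α} (hx₀ : f x₀ ≠ ⊤)
    {c : ℝ≥0∞} (hc₀ : c ≠ 0) (hc : c ≠ ⊤) :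
    ∃ y, f y + c * edist y x₀ ≤ f x₀ ∧ ∀ z, f y ≤ f z + c * edist z y := by
  let S : α → Set α := fun x => {z | f z + c * edist z x ≤ f x}
  have hSself (x : α) : x ∈ S x := by simp [S]
  have hStrans {x y z : α} (hzy : z ∈ S y) (hyx : y ∈ S x) : z ∈ S x := by
    calc f z + c * edist z x ≤ f z + c * (edist z y + edist y x) := by
          gcongr; exact edist_triangle _ _ _
      _ = (f z + c * edist z y) + c * edist y x := by ring
      _ ≤ f y + c * edist y x := by gcongr; exact hzy
      _ ≤ f x := hyx
  have hSle {x y : α} (hy : y ∈ S x) : f y ≤ f x := le_self_add.trans hy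
  have hSclosed (x : α) : IsClosed (S x) := by
    have hcont : Continuous fun z => c * edist z x :=
      ENNReal.continuous_const_mul hc |>.comp (by fun_prop)
    exact (hf.add hcont.lowerSemicontinuous).isClosed_preimage (f x)
  have hstep (n : ℕ) (x : {x // f x ≠ ⊤}) : ∃ y : {x // f x ≠ ⊤}, y.1 ∈ S x ∧
      f y ≤ (⨅ z ∈ S x.1, f z) + c * 2⁻¹ ^ n := by
    have hfin : (⨅ z ∈ S x.1, f z) ≠ ⊤ := ne_top_of_le_ne_top x.2 (iInf₂_le _ (hSself x))
    have hpos : c * 2⁻¹ ^ n ≠ 0 := mul_ne_zero hc₀ (pow_ne_zero _ (by simp))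
    obtain ⟨y, hy, hylt⟩ : ∃ y ∈ S x.1, f y < (⨅ z ∈ S x.1, f z) + c * 2⁻¹ ^ n := by
      simpa only [iInf_lt_iff, exists_prop] using ENNReal.lt_add_right hfin hpos
    exact ⟨⟨y, ne_top_of_le_ne_top x.2 (hSle hy)⟩, hy, hylt.le⟩
  choose next hnext hnext_le using hstep
  let u : ℕ → {x // f x ≠ ⊤} := fun n => Nat.rec ⟨x₀, hx₀⟩ next n
  have hmem {n m : ℕ} (hnm : n ≤ m) : (u m).1 ∈ S (u n).1 := by
    induction m, hnm using Nat.le_induction with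
    | base => exact hSself _
    | succ m _ ih => exact hStrans (hnext m (u m)) ih
  have hclose {n : ℕ} {z : α} (hz : z ∈ S (u (n + 1)).1) : edist z (u (n + 1)) ≤ 2⁻¹ ^ n := by
    have hz' : z ∈ S (u n).1 := hStrans hz (hmem (Nat.le_add_right n 1))
    have hzfin : f z ≠ ⊤ := ne_top_of_le_ne_top (u n).2 (hSle hz')
    have h : f z + c * edist z (u (n + 1)) ≤ f z + c * 2⁻¹ ^ n :=
      calc _ ≤ f (u (n + 1)) := hz
        _ ≤ (⨅ w ∈ S (u n).1, f w) + c * 2⁻¹ ^ n := hnext_le n (u n)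
        _ ≤ f z + c * 2⁻¹ ^ n := by gcongr; exact iInf₂_le _ hz'
    exact (ENNReal.mul_le_mul_iff_right hc₀ hc).1 ((ENNReal.add_le_add_iff_left hzfin).1 h)
  have hlim {z : α} (hz : ∀ n, z ∈ S (u n).1) : Tendsto (fun n => (u (n + 1)).1) atTop (𝓝 z) := by
    rw [tendsto_iff_edist_tendsto_0]
    refine tendsto_of_tendsto_of_tendsto_of_le_of_le tendsto_const_nhds
      (ENNReal.tendsto_pow_atTop_nhds_zero_of_lt_one (r := 2⁻¹) (by simp)) (fun _ => zero_le) ?_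
    exact fun n => (edist_comm _ _).trans_le (hclose (hz (n + 1)))
  have hcauchy : CauchySeq fun n => (u (n + 1)).1 := by
    refine cauchySeq_of_edist_le_geometric 2⁻¹ 1 (by simp) (by simp) fun n => ?_
    rw [one_mul, edist_comm]
    exact hclose (hmem (Nat.le_add_right (n + 1) 1))
  obtain ⟨y, hy⟩ := cauchySeq_tendsto_of_complete hcauchy
  have hyS (n : ℕ) : y ∈ S (u n).1 :=
    (hSclosed _).mem_of_tendsto hy <| (eventually_ge_atTop n).mono fun m hm =>
      hmem (hm.trans m.le_succ)
  refine ⟨y, hyS 0, fun z => ?_⟩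
  by_contra! hlt
  have hzy : z = y := tendsto_nhds_unique (hlim fun n => hStrans hlt.le (hyS n)) hy
  simp [hzy] at hlt

/-- Hahn–Banach sandwich: a continuous concave function on an open convex set lying below a convex
subset of `E × ℝ` is separated from it by a continuous affine function. -/
theorem Convex.exists_affine_between {E : Type*} [NormedAddCommGroup E] [NormedSpace ℝ E]
    {D : Set (E × ℝ)} (hD : Convex ℝ D) {U : Set E} (hU : IsOpen U) {k : E → ℝ}
    (hk : ConcaveOn ℝ U k) (hkc : Continuous k) (hkD : ∀ z ∈ D, z.1 ∈ U → k z.1 ≤ z.2)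
    (hne : ∃ z ∈ D, z.1 ∈ U) :
    ∃ (p : E →L[ℝ] ℝ) (b : ℝ), (∀ z ∈ D, p z.1 + b ≤ z.2) ∧ ∀ x ∈ U, k x ≤ p x + b := by
  have hV : IsOpen {z : E × ℝ | z.1 ∈ U ∧ z.2 < k z.1} :=
    (hU.preimage continuous_fst).inter (isOpen_lt continuous_snd (hkc.comp continuous_fst))
  have hdisj : Disjoint {z : E × ℝ | z.1 ∈ U ∧ z.2 < k z.1} D :=
    Set.disjoint_left.2 fun z hz hzD => (hkD z hzD hz.1).not_gt hz.2
  obtain ⟨f, u, hfV, hfD⟩ :=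
    geometric_hahn_banach_open hk.convex_strict_hypograph hV hD hdisj
  let a : ℝ := f (0, 1)
  let g : E →L[ℝ] ℝ := f.comp (ContinuousLinearMap.inl ℝ E ℝ)
  have hf (x : E) (s : ℝ) : f (x, s) = g x + s * a := by
    have : (x, s) = (x, (0 : ℝ)) + s • ((0 : E), (1 : ℝ)) := by simp
    rw [this, map_add, map_smul]
    simp [g, a]
  obtain ⟨⟨x₁, t₁⟩, hz₁, hx₁⟩ := hne
  have ha : 0 < a := by
    have h₁ := hfV (x₁, k x₁ - 1) ⟨hx₁, by simp⟩
    have h₂ := hfD _ hz₁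
    have h₃ := hkD _ hz₁ hx₁
    rw [hf] at h₁ h₂
    simp only at h₃
    by_contra! hneg
    nlinarith
  refine ⟨-a⁻¹ • g, a⁻¹ * u, ?_, ?_⟩
  · rintro ⟨x, t⟩ hz
    have h := hfD _ hz
    rw [hf] at h
    have : a⁻¹ * (u - g x) ≤ t := by rw [inv_mul_le_iff₀ ha]; linarith
    simp only [_root_.smul_apply, smul_eq_mul]
    linarith
  · intro x hx
    refine le_of_forall_lt fun s hs => ?_
    have h := hfV (x, s) ⟨hx, hs⟩
    rw [hf] at h
    have : s < a⁻¹ * (u - g x) := by rw [lt_inv_mul_iff₀ ha]; linarith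
    simp only [_root_.smul_apply, smul_eq_mul]
    linarith

section MinimalTime

variable [NormedAddCommGroup X] [NormedSpace ℝ X] {Ω F : Set X}

/-- Pairs `(x, t)` such that the target can be reached from `x` in time exactly `t`. -/
def reachable (Ω F : Set X) : Set (X × ℝ) :=
  {z | 0 ≤ z.2 ∧ ∃ q ∈ F, z.1 + z.2 • q ∈ Ω}

theorem exists_smul_eq_add_smul (hF : Convex ℝ F) {s t : ℝ} (hs : 0 ≤ s) (ht : 0 ≤ t)
    {q q' : X} (hq : q ∈ F) (hq' : q' ∈ F) :
    ∃ w ∈ F, (s + t) • w = s • q + t • q' := by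
  have h : s • q + t • q' ∈ (s + t) • F := by
    rw [hF.add_smul hs ht]
    exact Set.add_mem_add (Set.smul_mem_smul_set hq) (Set.smul_mem_smul_set hq')
  exact h

theorem convex_reachable (hF : Convex ℝ F) (hΩ : Convex ℝ Ω) : Convex ℝ (reachable Ω F) := by
  rintro ⟨x, t⟩ ⟨ht, q, hq, hx⟩ ⟨y, s⟩ ⟨hs, q', hq', hy⟩ a b ha hb hab
  simp only at ht hs hx hy
  obtain ⟨w, hw, hwq⟩ := exists_smul_eq_add_smul hF (mul_nonneg ha ht) (mul_nonneg hb hs) hq hq'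
  refine ⟨by simp only [Prod.smul_mk, Prod.mk_add_mk, smul_eq_mul]; positivity, w, hw, ?_⟩
  convert hΩ hx hy ha hb hab using 1
  simp only [Prod.smul_mk, Prod.mk_add_mk, smul_eq_mul, hwq]
  module

theorem mtime_le_of_mem_reachable {x : X} {t : ℝ} (h : (x, t) ∈ reachable Ω F) :
    mtime Ω F x ≤ ENNReal.ofReal t :=
  iInf₂_le t h

theorem exists_mem_reachable_of_mtime_lt {x : X} {a : ℝ≥0∞} (h : mtime Ω F x < a) :
    ∃ t, (x, t) ∈ reachable Ω F ∧ ENNReal.ofReal t < a := by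
  simp only [mtime, iInf_lt_iff, exists_prop] at h
  exact h

theorem ofReal_le_mtime_iff {x : X} {a : ℝ} :
    ENNReal.ofReal a ≤ mtime Ω F x ↔ ∀ t, (x, t) ∈ reachable Ω F → a ≤ t := by
  refine le_iInf₂_iff.trans (forall_congr' fun t => forall_congr' fun ht => ?_)
  exact ENNReal.ofReal_le_ofReal_iff ht.1

/-- An affine-minus-norm minorant of the minimal time function near `x₀`, exact at `x₀`,
is a global minorant. -/
theorem le_of_local_minorant (hF : Convex ℝ F) (hΩ : Convex ℝ Ω) {x₀ : X}
    (hx₀ : mtime Ω F x₀ ≠ ⊤) {l : X →L[ℝ] ℝ} {c δ : ℝ} (hδ : 0 < δ)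
    (h : ∀ x, ‖x - x₀‖ < δ →
      ENNReal.ofReal ((mtime Ω F x₀).toReal + l (x - x₀) - c * ‖x - x₀‖) ≤ mtime Ω F x)
    {x : X} {t : ℝ} (hxt : (x, t) ∈ reachable Ω F) :
    (mtime Ω F x₀).toReal + l (x - x₀) - c * ‖x - x₀‖ ≤ t := by
  set r := (mtime Ω F x₀).toReal
  obtain ⟨a, ha₀, ha₁, haδ⟩ : ∃ a : ℝ, 0 < a ∧ a ≤ 1 ∧ a * ‖x - x₀‖ < δ := by
    refine ⟨min 1 (δ / (‖x - x₀‖ + 1)), by positivity, min_le_left _ _, ?_⟩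
    calc min 1 (δ / (‖x - x₀‖ + 1)) * ‖x - x₀‖ ≤ δ / (‖x - x₀‖ + 1) * ‖x - x₀‖ := by
          gcongr; exact min_le_right _ _
      _ < δ := by
          rw [div_mul_eq_mul_div, div_lt_iff₀ (by positivity)]
          nlinarith [norm_nonneg (x - x₀)]
  have hsub : x₀ + a • (x - x₀) - x₀ = a • (x - x₀) := by abel
  have hnorm : ‖a • (x - x₀)‖ = a * ‖x - x₀‖ := by
    rw [norm_smul, Real.norm_of_nonneg ha₀.le]
  have hmin := h (x₀ + a • (x - x₀)) (by rwa [hsub, hnorm])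
  rw [hsub, hnorm, map_smul, smul_eq_mul, ofReal_le_mtime_iff] at hmin
  have hbound (s : ℝ) (hs : r < s) :
      r + a * l (x - x₀) - c * (a * ‖x - x₀‖) ≤ (1 - a) * s + a * t := by
    obtain ⟨s', hs', hlt⟩ := exists_mem_reachable_of_mtime_lt
      (show mtime Ω F x₀ < ENNReal.ofReal s from (ENNReal.lt_ofReal_iff_toReal_lt hx₀).2 hs)
    have hs's : s' ≤ s := (ENNReal.ofReal_lt_ofReal_iff'.1 hlt).1.le
    have hmem := convex_reachable hF hΩ hs' hxt (sub_nonneg.2 ha₁) ha₀.le (by ring)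
    have hmem' : (x₀ + a • (x - x₀), (1 - a) * s' + a * t) ∈ reachable Ω F := by
      convert hmem using 1
      simp only [Prod.smul_mk, Prod.mk_add_mk, smul_eq_mul, Prod.mk.injEq, and_true]
      module
    have h₁ : (1 - a) * s' ≤ (1 - a) * s := mul_le_mul_of_nonneg_left hs's (sub_nonneg.2 ha₁)
    linarith [hmin _ hmem']
  have hlimit : r + a * l (x - x₀) - c * (a * ‖x - x₀‖) ≤ (1 - a) * r + a * t := by
    have hcont : Tendsto (fun s => (1 - a) * s + a * t) (𝓝[>] r) (𝓝 ((1 - a) * r + a * t)) :=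
      (Continuous.tendsto (by fun_prop) r).mono_left nhdsWithin_le_nhds
    exact ge_of_tendsto hcont (eventually_nhdsWithin_of_forall hbound)
  have : a * (r + l (x - x₀) - c * ‖x - x₀‖) ≤ a * t := by linarith
  exact le_of_mul_le_mul_left this ha₀

theorem mem_fsub_of_affine_minorant {x₀ : X} {p : X →L[ℝ] ℝ} {ε : ℝ} (hε : 0 ≤ ε)
    (h : ∀ z ∈ reachable Ω F, (mtime Ω F x₀).toReal + p (z.1 - x₀) ≤ z.2) :
    p ∈ fsub (mtime Ω F) ε x₀ := by
  refine fun γ hγ => ⟨1, one_pos, fun x _ => ofReal_le_mtime_iff.2 fun t ht => ?_⟩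
  have : 0 ≤ (ε + γ) * ‖x - x₀‖ := by positivity
  linarith [h _ ht]

/-- Singular subgradients of a convex minimal time function are normal to its domain. -/
theorem apply_sub_nonpos_of_mem_ssub [CompleteSpace X] (hF : Convex ℝ F) (hΩ : Convex ℝ Ω)
    {xb : X} (hxb : mtime Ω F xb ≠ ⊤) {p : X →L[ℝ] ℝ} (hp : p ∈ ssub (mtime Ω F) xb)
    {x : X} {t : ℝ} (hxt : (x, t) ∈ reachable Ω F) : p (x - xb) ≤ 0 := by
  obtain ⟨ε, lam, y, ps, hε₀, hε, hlam₀, hlam, hy, hTy, hps, hlim⟩ := hp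
  let g : ℕ → X →L[ℝ] ℝ := fun k => lam k • ps k
  have hg (v : X) : Tendsto (fun k => g k v) atTop (𝓝 (p v)) := hlim v
  obtain ⟨C, hC⟩ : ∃ C, ∀ k, ‖g k‖ ≤ C := by
    refine banach_steinhaus fun v => ?_
    obtain ⟨M, hM⟩ := (Metric.isBounded_range_of_tendsto _ (hg v)).exists_norm_le
    exact ⟨M, fun k => hM _ (mem_range_self k)⟩
  have hgy : Tendsto (fun k => g k (y k - xb)) atTop (𝓝 0) := by
    refine squeeze_zero_norm (a := fun k => C * ‖y k - xb‖) (fun k => ?_) ?_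
    · exact ((g k).le_opNorm _).trans (by gcongr; exact hC k)
    · simpa using ((tendsto_sub_nhds_zero_iff.2 hy).norm.const_mul C)
  have hleft : Tendsto (fun k => g k (x - xb) - g k (y k - xb)) atTop (𝓝 (p (x - xb))) := by
    simpa using (hg (x - xb)).sub hgy
  have hright : Tendsto (fun k => lam k * (t + (ε k + 1) * ‖x - y k‖)) atTop (𝓝 0) := by
    simpa using hlam.mul ((((hε.add_const 1).mul (tendsto_const_nhds.sub hy).norm)).const_add t)
  refine le_of_tendsto_of_tendsto hleft hright ?_
  filter_upwards [hTy.eventually_ne hxb] with k hk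
  obtain ⟨δ, hδ, hmin⟩ := hps k 1 one_pos
  have h := le_of_local_minorant hF hΩ hk hδ hmin hxt
  have hr : 0 ≤ (mtime Ω F (y k)).toReal := ENNReal.toReal_nonneg
  rw [← map_sub, sub_sub_sub_cancel_right]
  have hle : ps k (x - y k) ≤ t + (ε k + 1) * ‖x - y k‖ := by linarith
  exact mul_le_mul_of_nonneg_left hle (hlam₀ k).le

/-- Lower semicontinuity of a convex minimal time function yields approximate subgradients. -/
theorem exists_approx_subgradient (hF : Convex ℝ F) (hΩ : Convex ℝ Ω) {xb : X}
    (hxb : mtime Ω F xb ≠ ⊤) {δ ε : ℝ} (hδ : 0 < δ)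
    (hlow : ∀ x ∈ Metric.ball xb δ, ENNReal.ofReal ((mtime Ω F xb).toReal - ε) ≤ mtime Ω F x) :
    ∃ q : X →L[ℝ] ℝ, ∀ z ∈ reachable Ω F,
      (mtime Ω F xb).toReal - ε + q (z.1 - xb) ≤ z.2 := by
  obtain ⟨t, ht, -⟩ := exists_mem_reachable_of_mtime_lt hxb.lt_top
  obtain ⟨q, b, hqD, hqU⟩ := (convex_reachable hF hΩ).exists_affine_between
    Metric.isOpen_ball (concaveOn_const ((mtime Ω F xb).toReal - ε) (convex_ball xb δ))
    continuous_const (fun z hz hzU => ofReal_le_mtime_iff.1 (hlow _ hzU) _ hz)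
    ⟨_, ht, Metric.mem_ball_self hδ⟩
  refine ⟨q, fun z hz => ?_⟩
  have h₁ := hqD z hz
  have h₂ := hqU xb (Metric.mem_ball_self hδ)
  rw [map_sub]
  linarith

/-- A norm-perturbed minorant exact at `y` yields a genuine subgradient at `y` nearby. -/
theorem exists_subgradient_near (hF : Convex ℝ F) (hΩ : Convex ℝ Ω) {y : X}
    (hy : mtime Ω F y ≠ ⊤) {l : X →L[ℝ] ℝ} {c : ℝ} (hc : 0 ≤ c)
    (h : ∀ z ∈ reachable Ω F,
      (mtime Ω F y).toReal + l (z.1 - y) - c * ‖z.1 - y‖ ≤ z.2) :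
    ∃ p : X →L[ℝ] ℝ, (∀ z ∈ reachable Ω F, (mtime Ω F y).toReal + p (z.1 - y) ≤ z.2) ∧
      ∀ v, |p v - l v| ≤ c * ‖v‖ := by
  set r := (mtime Ω F y).toReal
  obtain ⟨t, ht, -⟩ := exists_mem_reachable_of_mtime_lt hy.lt_top
  have hconc : ConcaveOn ℝ univ fun x => r + l (x - y) - c * ‖x - y‖ := by
    refine ⟨convex_univ, fun u _ v _ a b ha hb hab => ?_⟩
    have hsplit : a • u + b • v - y = a • (u - y) + b • (v - y) := by
      rw [smul_sub, smul_sub, sub_add_sub_comm, ← add_smul, hab, one_smul]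
    have hnorm : ‖a • (u - y) + b • (v - y)‖ ≤ a * ‖u - y‖ + b * ‖v - y‖ := by
      simpa [norm_smul, abs_of_nonneg ha, abs_of_nonneg hb] using
        norm_add_le (a • (u - y)) (b • (v - y))
    have hrab : r = a * r + b * r := by rw [← add_mul, hab, one_mul]
    simp only [hsplit, map_add, map_smul, smul_eq_mul]
    linarith [mul_le_mul_of_nonneg_left hnorm hc]
  obtain ⟨p, b, hpD, hpU⟩ := (convex_reachable hF hΩ).exists_affine_between
    isOpen_univ hconc (by fun_prop) (fun z hz _ => h z hz) ⟨_, ht, mem_univ _⟩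
  have hb_le : p y + b ≤ r :=
    (ENNReal.ofReal_le_iff_le_toReal hy).1 (ofReal_le_mtime_iff.2 fun s hs => hpD _ hs)
  have hle_b : r ≤ p y + b := by simpa using hpU y (mem_univ _)
  have hlow (v : X) : l v - c * ‖v‖ ≤ p v := by
    have h := hpU (y + v) (mem_univ _)
    simp only [add_sub_cancel_left, map_add] at h
    linarith
  refine ⟨p, fun z hz => ?_, fun v => abs_le.2 ⟨by linarith [hlow v], ?_⟩⟩
  · rw [map_sub]
    linarith [hpD z hz]
  · have h := hlow (-v)
    simp only [map_neg, norm_neg] at h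
    linarith

/-- Every normal to the domain of a convex minimal time function that is lower semicontinuous near
`xb` is approximated by scaled subgradients at nearby points with nearby values. -/
theorem exists_scaled_subgradient_near [CompleteSpace X] (hF : Convex ℝ F) (hΩ : Convex ℝ Ω)
    {xb : X} (hxb : mtime Ω F xb ≠ ⊤)
    (hlsc : ∃ U ∈ 𝓝 xb, LowerSemicontinuousOn (mtime Ω F) U) {p : X →L[ℝ] ℝ}
    (hp : ∀ z ∈ reachable Ω F, p (z.1 - xb) ≤ 0) {η : ℝ} (hη : 0 < η) :
    ∃ (lam : ℝ) (y : X) (p' : X →L[ℝ] ℝ), 0 < lam ∧ lam ≤ η ∧ ‖y - xb‖ ≤ η ∧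
      mtime Ω F y ≠ ⊤ ∧ |(mtime Ω F y).toReal - (mtime Ω F xb).toReal| ≤ η ∧
      p' ∈ fsub (mtime Ω F) 0 y ∧ ∀ v, |lam * p' v - p v| ≤ η * ‖v‖ := by
  obtain ⟨U, hU, hlsc⟩ := hlsc
  set r := (mtime Ω F xb).toReal with hr
  have hnear : ∀ᶠ x in 𝓝 xb, x ∈ U ∧ ENNReal.ofReal (r - η) ≤ mtime Ω F x := by
    refine Filter.Eventually.and hU ?_
    rcases le_or_gt r η with hrη | hrη
    · filter_upwards with x
      simp [ENNReal.ofReal_of_nonpos (sub_nonpos.2 hrη)]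
    · have hlt : ENNReal.ofReal (r - η) < mtime Ω F xb :=
        (ENNReal.ofReal_lt_iff_lt_toReal (sub_pos.2 hrη).le hxb).2 (by linarith)
      have h := hlsc xb (mem_of_mem_nhds hU) _ hlt
      rw [nhdsWithin_eq_nhds.2 hU] at h
      exact h.mono fun x hx => hx.le
  obtain ⟨δ, hδ, hball⟩ := Metric.eventually_nhds_iff_ball.1 hnear
  obtain ⟨q, hq⟩ := exists_approx_subgradient hF hΩ hxb hδ fun x hx => (hball x hx).2
  obtain ⟨ρ, hρ, hρδ, hρη, hρq⟩ : ∃ ρ : ℝ, 0 < ρ ∧ ρ < δ ∧ ρ ≤ η ∧ ‖q‖ * ρ ≤ η := by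
    refine ⟨min (δ / 2) (η / (‖q‖ + 1)), by positivity, by
      linarith [min_le_left (δ / 2) (η / (‖q‖ + 1))], ?_, ?_⟩
    · exact (min_le_right _ _).trans (div_le_self hη.le (by linarith [norm_nonneg q]))
    · calc ‖q‖ * min (δ / 2) (η / (‖q‖ + 1)) ≤ ‖q‖ * (η / (‖q‖ + 1)) := by
            gcongr; exact min_le_right _ _
        _ ≤ η := by
            rw [mul_div_assoc', div_le_iff₀ (by positivity)]
            nlinarith [norm_nonneg q]
  have hKU {x : X} (hx : x ∈ Metric.closedBall xb ρ) : x ∈ Metric.ball xb δ :=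
    Metric.closedBall_subset_ball hρδ hx
  set c : ℝ := 2 * η / ρ with hc
  have hc₀ : 0 < c := by positivity
  obtain ⟨lam, hlam₀, hlamη, hlam⟩ : ∃ lam : ℝ, 0 < lam ∧ lam ≤ η ∧ lam * (c + ‖q‖) ≤ η := by
    refine ⟨min η (η / (c + ‖q‖)), by positivity, min_le_left _ _, ?_⟩
    rw [← le_div_iff₀ (by positivity)]
    exact min_le_right _ _
  set l : X →L[ℝ] ℝ := q + lam⁻¹ • p with hl
  have hl_le {z : X × ℝ} (hz : z ∈ reachable Ω F) : l (z.1 - xb) ≤ q (z.1 - xb) := by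
    have := mul_nonpos_of_nonneg_of_nonpos (inv_pos.2 hlam₀).le (hp z hz)
    simp only [hl, _root_.add_apply, _root_.smul_apply, smul_eq_mul]
    linarith
  set C : ℝ := ‖l‖ * ρ
  have hCl {x : X} (hx : x ∈ Metric.closedBall xb ρ) : 0 ≤ C - l (x - xb) := by
    have h₁ : l (x - xb) ≤ ‖l‖ * ‖x - xb‖ := (le_abs_self _).trans (l.le_opNorm _)
    have h₂ : ‖l‖ * ‖x - xb‖ ≤ ‖l‖ * ρ := by
      gcongr; exact mem_closedBall_iff_norm.1 hx
    linarith
  let G : X → ℝ≥0∞ := fun x => mtime Ω F x + ENNReal.ofReal (C - l (x - xb))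
  have hG : LowerSemicontinuousOn G (Metric.closedBall xb ρ) := by
    refine (hlsc.mono fun x hx => (hball x (hKU hx)).1).add (Continuous.lowerSemicontinuous ?_
      |>.lowerSemicontinuousOn _)
    exact ENNReal.continuous_ofReal.comp (by fun_prop)
  have : CompleteSpace (Metric.closedBall xb ρ) := Metric.isClosed_closedBall.completeSpace_coe
  obtain ⟨⟨y, hyK⟩, hy₁, hy₂⟩ := (lowerSemicontinuous_restrict_iff.2 hG).exists_ekeland
    (x₀ := ⟨xb, Metric.mem_closedBall_self hρ.le⟩) (c := ENNReal.ofReal c)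
    (by simp [G, hxb]) (by simpa using hc₀) ENNReal.ofReal_ne_top
  have hdist (u v : X) : ENNReal.ofReal c * edist u v = ENNReal.ofReal (c * ‖u - v‖) := by
    rw [edist_dist, dist_eq_norm, ENNReal.ofReal_mul hc₀.le]
  simp only [Subtype.forall, Set.domRestrict_apply, Subtype.edist_mk_mk, hdist, G] at hy₁ hy₂
  have hyT : mtime Ω F y ≠ ⊤ := by
    refine ne_top_of_le_ne_top ?_ ((le_self_add.trans le_self_add).trans hy₁)
    simp [hxb]
  set τ := (mtime Ω F y).toReal
  have hyτ : mtime Ω F y = ENNReal.ofReal τ := (ENNReal.ofReal_toReal hyT).symm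
  have hτ₀ : 0 ≤ τ := ENNReal.toReal_nonneg
  have hr₀ : 0 ≤ r := ENNReal.toReal_nonneg
  have hC₀ : 0 ≤ C := by positivity
  have hdecrease : τ - l (y - xb) + c * ‖y - xb‖ ≤ r := by
    rw [hyτ, ← ENNReal.ofReal_toReal hxb, ← hr, sub_self, map_zero, sub_zero,
      ← ENNReal.ofReal_add hτ₀ (hCl hyK), ← ENNReal.ofReal_add (add_nonneg hτ₀ (hCl hyK))
        (by positivity), ← ENNReal.ofReal_add hr₀ hC₀,
      ENNReal.ofReal_le_ofReal_iff (by positivity)] at hy₁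
    linarith
  obtain ⟨s, hs, -⟩ := exists_mem_reachable_of_mtime_lt hyT.lt_top
  have hτ_lower : r - η + q (y - xb) ≤ τ :=
    (ENNReal.ofReal_le_iff_le_toReal hyT).1 (ofReal_le_mtime_iff.2 fun s hs => hq _ hs)
  have hly : l (y - xb) ≤ q (y - xb) := hl_le hs
  have hyρ : ‖y - xb‖ ≤ ρ / 2 := by
    have h : c * ‖y - xb‖ ≤ c * (ρ / 2) := by
      have : c * (ρ / 2) = η := by rw [hc]; field_simp
      linarith
    exact le_of_mul_le_mul_left h hc₀
  have hlocal (x : X) (hx : ‖x - y‖ < ρ / 2) :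
      ENNReal.ofReal (τ + l (x - y) - c * ‖x - y‖) ≤ mtime Ω F x := by
    have hxK : x ∈ Metric.closedBall xb ρ := by
      rw [mem_closedBall_iff_norm]
      linarith [norm_sub_le_norm_sub_add_norm_sub x y xb]
    refine ofReal_le_mtime_iff.2 fun t ht => ?_
    have h := (hy₂ x hxK).trans
      (add_le_add_left (add_le_add_left (mtime_le_of_mem_reachable ht) _) _)
    have ht₀ : 0 ≤ t := ht.1
    rw [hyτ, ← ENNReal.ofReal_add hτ₀ (hCl hyK), ← ENNReal.ofReal_add ht₀ (hCl hxK),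
      ← ENNReal.ofReal_add (add_nonneg ht₀ (hCl hxK)) (by positivity),
      ENNReal.ofReal_le_ofReal_iff
        (add_nonneg (add_nonneg ht₀ (hCl hxK)) (by positivity))] at h
    have hsplit : l (x - y) = l (x - xb) - l (y - xb) := by
      rw [← map_sub, sub_sub_sub_cancel_right]
    linarith
  obtain ⟨p', hp', hp'l⟩ := exists_subgradient_near hF hΩ hyT hc₀.le fun z hz =>
    le_of_local_minorant hF hΩ hyT (half_pos hρ) hlocal hz
  refine ⟨lam, y, p', hlam₀, hlamη, by linarith, hyT, abs_le.2 ⟨?_, ?_⟩,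
    mem_fsub_of_affine_minorant le_rfl hp', fun v => ?_⟩
  · have := (ENNReal.ofReal_le_iff_le_toReal hyT).1 (hball y (hKU hyK)).2
    linarith
  · have h₁ : q (y - xb) ≤ ‖q‖ * ‖y - xb‖ := (le_abs_self _).trans (q.le_opNorm _)
    have h₂ : ‖q‖ * ‖y - xb‖ ≤ ‖q‖ * ρ := by gcongr; linarith
    have h₃ : 0 ≤ c * ‖y - xb‖ := by positivity
    linarith
  · have hlv : lam * l v = lam * q v + p v := by
      simp only [hl, _root_.add_apply, _root_.smul_apply, smul_eq_mul]
      field_simp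
    calc |lam * p' v - p v| = |lam * ((p' v - l v) + q v)| := by
          congr 1; linear_combination hlv
      _ = lam * |(p' v - l v) + q v| := by rw [abs_mul, abs_of_pos hlam₀]
      _ ≤ lam * (c * ‖v‖ + ‖q‖ * ‖v‖) := by
          gcongr
          exact (abs_add_le _ _).trans (add_le_add (hp'l v) (q.le_opNorm v))
      _ = lam * (c + ‖q‖) * ‖v‖ := by ring
      _ ≤ η * ‖v‖ := by gcongr

/-- The singular subdifferential of a convex minimal time function that is lower semicontinuous
near `xb` is the normal cone to its domain. -/
theorem mem_ssub_mtime_iff [CompleteSpace X] (hF : Convex ℝ F) (hΩ : Convex ℝ Ω)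
    {xb : X} (hxb : mtime Ω F xb ≠ ⊤)
    (hlsc : ∃ U ∈ 𝓝 xb, LowerSemicontinuousOn (mtime Ω F) U) {p : X →L[ℝ] ℝ} :
    p ∈ ssub (mtime Ω F) xb ↔ ∀ z ∈ reachable Ω F, p (z.1 - xb) ≤ 0 := by
  refine ⟨fun hp z hz => apply_sub_nonpos_of_mem_ssub hF hΩ hxb hp hz, fun hp => ?_⟩
  choose lam y p' hlam₀ hlam hy hyT hTy hp' hlim using fun k : ℕ =>
    exists_scaled_subgradient_near hF hΩ hxb hlsc hp (Nat.one_div_pos_of_nat (α := ℝ) (n := k))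
  have hη : Tendsto (fun k : ℕ => 1 / ((k : ℝ) + 1)) atTop (𝓝 0) :=
    tendsto_one_div_add_atTop_nhds_zero_nat
  refine ⟨fun _ => 0, lam, y, p', fun _ => le_rfl, tendsto_const_nhds, hlam₀,
    squeeze_zero (fun k => (hlam₀ k).le) hlam hη, ?_, ?_, hp', fun v => ?_⟩
  · exact tendsto_iff_norm_sub_tendsto_zero.2 (squeeze_zero (fun _ => norm_nonneg _) hy hη)
  · rw [← ENNReal.tendsto_toReal_iff hyT hxb, tendsto_iff_norm_sub_tendsto_zero]
    exact squeeze_zero (fun _ => norm_nonneg _) hTy hη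
  · rw [tendsto_iff_norm_sub_tendsto_zero]
    exact squeeze_zero (fun _ => norm_nonneg _) (fun k => hlim k v)
      (by simpa using hη.mul_const ‖v‖)

/-- The normal cone to the domain of a minimal time function, computed from any set between the
target and the domain. -/
theorem forall_reachable_apply_nonpos_iff (hF : Convex ℝ F) {xb : X}
    (hxb : mtime Ω F xb ≠ ⊤) {Θ : Set X} (hΩΘ : Ω ⊆ Θ) (hΘ : ∀ x ∈ Θ, mtime Ω F x ≠ ⊤)
    {p : X →L[ℝ] ℝ} :
    (∀ z ∈ reachable Ω F, p (z.1 - xb) ≤ 0) ↔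
      p ∈ cnormal Θ xb ∩ {p | ∀ v ∈ F, 0 ≤ p v} := by
  refine ⟨fun h => ⟨fun x hx => ?_, fun v hv => ?_⟩, ?_⟩
  · obtain ⟨t, ht, -⟩ := exists_mem_reachable_of_mtime_lt (hΘ x hx).lt_top
    exact h _ ht
  · obtain ⟨t, ⟨ht₀, q, hq, hxq⟩, -⟩ := exists_mem_reachable_of_mtime_lt hxb.lt_top
    simp only at ht₀ hxq
    obtain ⟨w, hw, hwq⟩ := exists_smul_eq_add_smul hF zero_le_one ht₀ hv hq
    have hmem : (xb - v, 1 + t) ∈ reachable Ω F := by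
      refine ⟨by simp only; positivity, w, hw, ?_⟩
      rwa [hwq, one_smul, ← add_assoc, sub_add_cancel]
    simpa using h _ hmem
  · rintro ⟨hpΘ, hpF⟩ ⟨x, t⟩ ⟨ht, q, hq, hx⟩
    have h₁ := hpΘ _ (hΩΘ hx)
    have h₂ := mul_nonneg ht (hpF q hq)
    simp only [map_sub, map_add, map_smul, smul_eq_mul] at h₁ h₂ ⊢
    linarith

theorem mtime_eq_zero_of_mem (hFne : F.Nonempty) {x : X} (hx : x ∈ Ω) : mtime Ω F x = 0 := by
  obtain ⟨q, hq⟩ := hFne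
  have h : (x, (0 : ℝ)) ∈ reachable Ω F := ⟨le_rfl, q, hq, by simpa using hx⟩
  simpa using mtime_le_of_mem_reachable h

end MinimalTime

/-- Theorem 7.2: singular subgradients of convex minimal time functions:
(i) at in-set points `∂^∞T(x̄) = N(x̄; Ω) ∩ F*₊`;
(ii) at out-of-set points `∂^∞T(x̄) = N(x̄; Ω_r) ∩ F*₊` with `r = T(x̄)`. -/
theorem ssub_mtime_convex [NormedAddCommGroup X] [NormedSpace ℝ X]
    [CompleteSpace X]
    (Ω F : Set X) (hΩne : Ω.Nonempty) (hΩcl : IsClosed Ω)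
    (hFne : F.Nonempty) (hFcl : IsClosed F) (hFbd : Bornology.IsBounded F)
    (hFcv : Convex ℝ F) (hΩcv : Convex ℝ Ω)
    (xb : X) (hlsc : ∃ U ∈ 𝓝 xb, LowerSemicontinuousOn (mtime Ω F) U) :
    (xb ∈ Ω →
      ssub (mtime Ω F) xb = cnormal Ω xb ∩ {p | ∀ v ∈ F, 0 ≤ p v}) ∧
    (xb ∉ Ω → mtime Ω F xb < ⊤ →
      ssub (mtime Ω F) xb =
        cnormal (enl Ω F (mtime Ω F xb).toReal) xb ∩
          {p | ∀ v ∈ F, 0 ≤ p v}) := by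
  have hzero {x : X} (hx : x ∈ Ω) : mtime Ω F x = 0 := mtime_eq_zero_of_mem hFne hx
  refine ⟨fun hxb => ?_, fun _ hxb => ?_⟩
  · have hfin : mtime Ω F xb ≠ ⊤ := by simp [hzero hxb]
    ext p
    rw [mem_ssub_mtime_iff hFcv hΩcv hfin hlsc]
    exact forall_reachable_apply_nonpos_iff hFcv hfin subset_rfl fun x hx => by simp [hzero hx]
  · ext p
    rw [mem_ssub_mtime_iff hFcv hΩcv hxb.ne hlsc]
    refine forall_reachable_apply_nonpos_iff hFcv hxb.ne (fun x hx => ?_) fun x hx => ?_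
    · simp [enl, hzero hx]
    · exact ne_top_of_le_ne_top ENNReal.ofReal_ne_top hx
end

section
/- Suppose the target Ω is convex, so T is convex, and let x̄ ∉ Ω be such that Π(x̄) ≠ ∅ and r := T(x̄) < ∞. Then for every w̄ ∈ Π(x̄) one has ∂T(x̄) = N(x̄; Ω_r) ∩ [−∂ρ_F(w̄ − x̄)] ⊆ N(w̄; Ω) ∩ [−∂ρ_F(w̄ − x̄)], where ∂ denotes the subdifferential of convex analysis and N the normal cone of convex analysis. If in addition 0 ∈ F, then the inclusion holds as equality: ∂T(x̄) = N(w̄; Ω) ∩ [−∂ρ_F(w̄ − x̄)]. -/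
open Set Filter Topology Pointwise
open scoped ENNReal

variable {X : Type*}

section Helpers

variable [NormedAddCommGroup X] [NormedSpace ℝ X]

theorem mtime_le {Ω F : Set X} {x q : X} {t : ℝ} (ht : 0 ≤ t) (hq : q ∈ F)
    (hx : x + t • q ∈ Ω) : mtime Ω F x ≤ ENNReal.ofReal t :=
  iInf₂_le t ⟨ht, q, hq, hx⟩

theorem mem_csub_mtime {Ω F : Set X} {xb : X} {p : X →L[ℝ] ℝ} :
    p ∈ csub (mtime Ω F) xb ↔ ∀ x, ∀ t : ℝ, 0 ≤ t → ∀ q ∈ F, x + t • q ∈ Ω →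
      p (x - xb) + (mtime Ω F xb).toReal ≤ t := by
  refine forall_congr' fun x => ⟨fun h t ht q hq hx => ?_, fun h => ?_⟩
  · exact (ENNReal.ofReal_le_ofReal_iff ht).1 (h.trans (mtime_le ht hq hx))
  · exact le_iInf₂ fun t ⟨ht, q, hq, hx⟩ => ENNReal.ofReal_le_ofReal (h t ht q hq hx)

theorem mem_csub_mgauge {F : Set X} {u : X} {p : X →L[ℝ] ℝ} :
    p ∈ csub (mgauge F) u ↔ ∀ t : ℝ, 0 ≤ t → ∀ q ∈ F,
      p (t • q - u) + (mgauge F u).toReal ≤ t := by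
  constructor
  · intro h t ht q hq
    exact (ENNReal.ofReal_le_ofReal_iff ht).1
      ((h (t • q)).trans (iInf₂_le t ⟨ht, q, hq, rfl⟩))
  · rintro h _
    exact le_iInf₂ fun t ⟨ht, q, hq, hx⟩ => hx ▸ ENNReal.ofReal_le_ofReal (h t ht q hq)

/-- The gauge of the displacement to a generalized projection is the minimal time. -/
theorem mgauge_sub_eq_mtime {Ω F : Set X} {xb wb : X} (hfin : mtime Ω F xb < ⊤)
    (hwb : wb ∈ mproj Ω F xb) : mgauge F (wb - xb) = mtime Ω F xb := by
  obtain ⟨hw, q, hq, hwq⟩ := hwb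
  apply le_antisymm
  · refine (iInf₂_le _ ⟨ENNReal.toReal_nonneg, q, hq, sub_eq_iff_eq_add'.2 hwq⟩).trans ?_
    rw [ENNReal.ofReal_toReal hfin.ne]
  · refine le_iInf₂ fun t ⟨ht, q', hq', h⟩ => mtime_le ht hq' ?_
    rwa [← h, add_sub_cancel]

theorem csub_mtime_subset {Ω F : Set X} {xb wb : X} (hfin : mtime Ω F xb < ⊤)
    (hwb : wb ∈ mproj Ω F xb) :
    csub (mtime Ω F) xb ⊆
      cnormal (enl Ω F (mtime Ω F xb).toReal) xb ∩ -csub (mgauge F) (wb - xb) := by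
  intro p hp
  refine ⟨fun x hx => ?_, ?_⟩
  · have h := (ENNReal.ofReal_le_ofReal_iff ENNReal.toReal_nonneg).1 ((hp x).trans hx)
    linarith
  · rw [Set.mem_neg, mem_csub_mgauge, mgauge_sub_eq_mtime hfin hwb]
    intro t ht q hq
    have h := mem_csub_mtime.1 hp (wb - t • q) t ht q hq (by simpa using hwb.1)
    simp only [neg_apply, map_sub] at h ⊢
    linarith

theorem cnormal_enl_subset {Ω F : Set X} {xb wb : X} (hwb : wb ∈ mproj Ω F xb) :
    cnormal (enl Ω F (mtime Ω F xb).toReal) xb ⊆ cnormal Ω wb := by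
  obtain ⟨-, q, hq, hwq⟩ := hwb
  intro p hp w hw
  have h := hp (w - (mtime Ω F xb).toReal • q)
    (mtime_le ENNReal.toReal_nonneg hq (by simpa using hw))
  rwa [sub_sub, add_comm _ xb, ← hwq] at h

theorem cnormal_inter_neg_csub_mgauge_subset {Ω F : Set X} {xb wb : X}
    (hfin : mtime Ω F xb < ⊤) (hwb : wb ∈ mproj Ω F xb) :
    cnormal Ω wb ∩ -csub (mgauge F) (wb - xb) ⊆ csub (mtime Ω F) xb := by
  rintro p ⟨hN, hG⟩
  rw [Set.mem_neg, mem_csub_mgauge, mgauge_sub_eq_mtime hfin hwb] at hG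
  refine mem_csub_mtime.2 fun x t ht q hq hx => ?_
  have h₁ := hN _ hx
  have h₂ := hG t ht q hq
  simp only [neg_apply, map_sub, map_add] at h₁ h₂ ⊢
  linarith

end Helpers

/-- Theorem 7.3: precise relationships between convex subdifferentials of
minimal time and Minkowski functions at out-of-set points. -/
theorem csub_mtime_mgauge_convex [NormedAddCommGroup X] [NormedSpace ℝ X]
    [CompleteSpace X]
    (Ω F : Set X) (hΩne : Ω.Nonempty) (hΩcl : IsClosed Ω)
    (hFne : F.Nonempty) (hFcl : IsClosed F) (hFbd : Bornology.IsBounded F)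
    (hFcv : Convex ℝ F) (hΩcv : Convex ℝ Ω)
    (xb : X) (hxb : xb ∉ Ω) (hfin : mtime Ω F xb < ⊤)
    (hne : (mproj Ω F xb).Nonempty) (wb : X) (hwb : wb ∈ mproj Ω F xb) :
    (csub (mtime Ω F) xb =
      cnormal (enl Ω F (mtime Ω F xb).toReal) xb ∩
        (-(csub (mgauge F) (wb - xb)))) ∧
    (csub (mtime Ω F) xb ⊆
      cnormal Ω wb ∩ (-(csub (mgauge F) (wb - xb)))) ∧
    (0 ∈ F →
      csub (mtime Ω F) xb = cnormal Ω wb ∩ (-(csub (mgauge F) (wb - xb)))) := by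
  have h₁ := csub_mtime_subset hfin hwb
  have h₂ := inter_subset_inter_left (-csub (mgauge F) (wb - xb)) (cnormal_enl_subset hwb)
  have h₃ := cnormal_inter_neg_csub_mgauge_subset hfin hwb
  exact ⟨h₁.antisymm (h₂.trans h₃), h₁.trans h₂, fun _ => (h₁.trans h₂).antisymm h₃⟩
end
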